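/- Let χ₁, χ₂ be primitive Dirichlet characters of conductors q₁, q₂ respectively, with q₁, q₂ > 1 and χ₁(−1)χ₂(−1) = 1, and let γ = (a b; c d) ∈ Γ₀(q₁q₂). Then for every z in the upper half-plane ℍ, f_{χ₁,χ₂}(γ·z) − (χ₁·conj(χ₂))(d)·f_{χ₁,χ₂}(z) = −χ₂(−1) · conj( f_{conj(χ₁),conj(χ₂)}(γ·z) − (conj(χ₁)·χ₂)(d)·f_{conj(χ₁),conj(χ₂)}(z) ). -/

import Mathlib

open Complex

/-- `e(w) = exp(2πiw)`. -/
noncomputable def eC (w : ℂ) : ℂ := Complex.exp (2 * Real.pi * Complex.I * w)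

/-- The holomorphic part `f_{χ₁,χ₂}(z) = ∑_{l≥1} ∑_{k≥1} (χ₁(l) conj(χ₂)(k) / l) e(klz)`. -/
noncomputable def fE {q₁ q₂ : ℕ} (χ₁ : DirichletCharacter ℂ q₁)
    (χ₂ : DirichletCharacter ℂ q₂) (z : ℂ) : ℂ :=
  ∑' l : ℕ+, ∑' k : ℕ+,
    χ₁ ((l : ℕ) : ZMod q₁) * (starRingEnd ℂ) (χ₂ ((k : ℕ) : ZMod q₂)) / (l : ℂ)
      * eC ((k : ℂ) * (l : ℂ) * z)

/-- The Gauss sum `τ(χ) = ∑_{n mod q} χ(n) e(n/q)`. -/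
noncomputable def gaussSum' {q : ℕ} (χ : DirichletCharacter ℂ q) : ℂ :=
  ∑ n ∈ Finset.range q, χ ((n : ℕ) : ZMod q) * eC ((n : ℂ) / (q : ℂ))

/-- The first Bernoulli function, `B₁(x) = x - ⌊x⌋ - 1/2` off ℤ, and `0` on ℤ. -/
noncomputable def B1 (x : ℝ) : ℝ := if Int.fract x = 0 then 0 else Int.fract x - 1 / 2


open Filter Topology

lemma phx_summable_line (W : ℂ) : Summable fun j : ℤ => (1 / Complex.normSq (W + j) : ℝ) := by
  have h := (EisensteinSeries.linear_right_summable W 1 (k := 2) le_rfl).norm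
  refine h.congr fun j => ?_
  rw [Complex.normSq_eq_norm_sq]
  simp

lemma phx_summable_plane (w : ℂ) (hw : 0 < w.im) (k : ℕ) (hk : 3 ≤ k) :
    Summable fun p : ℤ × ℤ => (1 / ‖(p.1 : ℂ) * w + p.2‖ ^ k : ℝ) := by
  have h := (summable_prod_eisSummand hk ⟨w, hw⟩).norm
  refine h.congr fun p => ?_
  simp [EisensteinSeries.eisSummand]

lemma phx_norm_eC (w : ℂ) : ‖eC w‖ = Real.exp (-(2 * Real.pi * w.im)) := by
  rw [eC, Complex.norm_exp]
  congr 1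
  simp

lemma phx_norm_eC_lt (w : ℂ) (hw : 0 < w.im) : ‖eC w‖ < 1 := by
  rw [phx_norm_eC, Real.exp_lt_one_iff]
  have := mul_pos (mul_pos two_pos Real.pi_pos) hw
  linarith

lemma phx_eC_nat (k : ℕ) (w : ℂ) : eC (k * w) = eC w ^ k := by
  rw [eC, eC, ← Complex.exp_nat_mul]
  congr 1; ring

lemma phx_eC_add (v w : ℂ) : eC (v + w) = eC v * eC w := by
  rw [eC, eC, eC, ← Complex.exp_add]
  congr 1; ring

lemma phx_eC_conj (w : ℂ) : (starRingEnd ℂ) (eC w) = eC (-(starRingEnd ℂ) w) := by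
  rw [eC, eC, ← Complex.exp_conj]
  congr 1
  simp only [map_mul, Complex.conj_I, Complex.conj_ofReal, map_ofNat]
  ring

lemma phx_summable_eC (w : ℂ) (hw : 0 < w.im) : Summable fun k : ℕ+ => ‖eC ((k : ℂ) * w)‖ := by
  have h := summable_geometric_of_lt_one (norm_nonneg (eC w)) (phx_norm_eC_lt w hw)
  have := (summable_pnat_iff_summable_nat (f := fun k : ℕ => ‖eC w‖ ^ k)).2 h
  refine this.congr fun k => ?_
  rw [← norm_pow, ← phx_eC_nat]

lemma phx_im_inv (w : ℂ) : (1 / w).im = - w.im * (1 / Complex.normSq w) := by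
  rw [one_div, Complex.inv_im]; ring

/-- the sum of `1/|W+j|^2` -/
lemma phx_P (W : ℂ) (hW : 0 < W.im) :
    (∑' j : ℤ, (1 / Complex.normSq (W + j) : ℝ)) =
      Real.pi / W.im * (1 + 2 * (∑' k : ℕ+, eC (k * W)).re) := by
  have hmem := UpperHalfPlane.coe_mem_integerComplement ⟨W, hW⟩
  have h1 := cot_series_rep' hmem
  have h2 := pi_mul_cot_pi_q_exp ⟨W, hW⟩
  have hs := summable_cotTerm hmem
  have hcoe : ((⟨W, hW⟩ : UpperHalfPlane) : ℂ) = W := rfl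
  rw [hcoe] at h1 h2 hs
  have hline := phx_summable_line W
  have hg := summable_geometric_of_norm_lt_one (phx_norm_eC_lt W hW)
  have hz0 := (tsum_zero_pnat_eq_tsum_nat hg).symm
  have e1 : (∑' n : ℕ, Complex.exp (2 * Real.pi * I * W) ^ n) = 1 + ∑' k : ℕ+, eC (k * W) := by
    change (∑' n : ℕ, eC W ^ n) = _
    rw [hz0, pow_zero]
    congr 1
    refine tsum_congr fun k => ?_
    rw [← phx_eC_nat]
  rw [h2, e1] at h1
  have him := congrArg Complex.im h1
  rw [Complex.im_tsum hs, Complex.sub_im, phx_im_inv] at him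
  rw [tsum_int_eq_zero_add_tsum_pnat hline]
  have s1 : Summable fun n : ℕ+ => (1 / Complex.normSq (W + ((n : ℕ) : ℤ)) : ℝ) :=
    hline.comp_injective (i := fun n : ℕ+ => ((n : ℕ) : ℤ)) (fun a b h => by simpa using h)
  have s2 : Summable fun n : ℕ+ => (1 / Complex.normSq (W + ((-((n : ℕ) : ℤ) : ℤ) : ℂ)) : ℝ) :=
    hline.comp_injective (i := fun n : ℕ+ => (-((n : ℕ) : ℤ))) (fun a b h => by simpa using h)
  rw [add_assoc, ← s1.tsum_add s2]
  have e2 : (∑' n : ℕ, (1 / (W - (n + 1)) + 1 / (W + (n + 1))).im) = 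
      - W.im * ∑' b : ℕ+, (1 / Complex.normSq (W + ((b : ℕ) : ℤ)) + 
        1 / Complex.normSq (W + ((-((b : ℕ) : ℤ) : ℤ) : ℂ))) := by
    rw [← tsum_mul_left]
    rw [tsum_pnat_eq_tsum_succ (f := fun b : ℕ => - W.im * (1 / Complex.normSq (W + ((b : ℕ) : ℤ)) + 
        1 / Complex.normSq (W + ((-((b : ℕ) : ℤ) : ℤ) : ℂ))))]
    refine tsum_congr fun n => ?_
    rw [Complex.add_im, phx_im_inv, phx_im_inv]
    have a1 : W - ((n : ℂ) + 1) = W + ((-(((n + 1 : ℕ)) : ℤ) : ℤ) : ℂ) := by push_cast; ring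
    have a2 : W + ((n : ℂ) + 1) = W + ((((n + 1 : ℕ)) : ℤ) : ℂ) := by push_cast; ring
    rw [a1, a2]
    simp
    ring
  rw [e2] at him
  have e3 : (Real.pi * I - 2 * Real.pi * I * (1 + ∑' k : ℕ+, eC (k * W)) : ℂ).im =
      -Real.pi * (1 + 2 * (∑' k : ℕ+, eC (k * W)).re) := by
    simp
    ring
  rw [e3] at him
  simp only [Int.cast_zero, add_zero]
  rw [div_mul_eq_mul_div, eq_div_iff hW.ne']
  linear_combination him

lemma phx_fin_sum {q : ℕ} [NeZero q] (F : ZMod q → ℂ) :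
    ∑ r : Fin q, F ((r : ℕ) : ZMod q) = ∑ x : ZMod q, F x := by
  refine Fintype.sum_bijective (fun r : Fin q => ((r : ℕ) : ZMod q)) ?_ _ _ (fun _ => rfl)
  rw [Fintype.bijective_iff_injective_and_card]
  refine ⟨fun a b h => ?_, by simp [ZMod.card]⟩
  have h' := (ZMod.natCast_eq_natCast_iff' _ _ _).1 h
  rw [Nat.mod_eq_of_lt a.2, Nat.mod_eq_of_lt b.2] at h'
  exact Fin.ext h'

lemma phx_conj_inv {q : ℕ} (χ : DirichletCharacter ℂ q) (x : ZMod q) :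
    (starRingEnd ℂ) (χ x) = χ⁻¹ x := by
  rw [← MulChar.star_eq_inv, MulChar.star_apply]
  rfl

lemma phx_gauss {q : ℕ} [NeZero q] (χ : DirichletCharacter ℂ q) (hχ : χ.IsPrimitive) (k : ℤ) :
    ∑ r : Fin q, χ ((r : ℕ) : ZMod q) * eC (k * ((r : ℕ) / (q : ℂ))) =
      (starRingEnd ℂ) (χ (k : ZMod q)) * gaussSum χ (ZMod.stdAddChar (N := q)) := by
  rw [phx_conj_inv, ← gaussSum_mulShift_of_isPrimitive _ hχ, gaussSum, ← phx_fin_sum]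
  refine Finset.sum_congr rfl fun r _ => ?_
  congr 1
  rw [AddChar.mulShift_apply]
  have : (k : ZMod q) * ((r : ℕ) : ZMod q) = ((k * (r : ℕ) : ℤ) : ZMod q) := by push_cast; rfl
  rw [this, ZMod.stdAddChar_coe, eC]
  congr 1
  push_cast
  ring

lemma phx_gauss_ne {q : ℕ} [NeZero q] (χ : DirichletCharacter ℂ q) (hχ : χ.IsPrimitive) :
    gaussSum χ (ZMod.stdAddChar (N := q)) ≠ 0 := by
  intro h
  have h1 : ZMod.dft (χ : ZMod q → ℂ) = 0 := by
    ext k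
    rw [DirichletCharacter.IsPrimitive.fourierTransform_eq_inv_mul_gaussSum hχ, h]
    simp
  have h2 : (χ : ZMod q → ℂ) = 0 := by simpa using h1
  have := congrFun h2 1
  simp at this

lemma phx_sum_zero {q : ℕ} [NeZero q] (hq : 1 < q) (χ : DirichletCharacter ℂ q)
    (hχ : χ.IsPrimitive) : ∑ r : Fin q, χ ((r : ℕ) : ZMod q) = 0 := by
  have h := phx_gauss χ hχ 0
  have : Fact (1 < q) := ⟨hq⟩
  simpa [eC, MulChar.map_zero] using h

noncomputable def phxA {q : ℕ} (χ : DirichletCharacter ℂ q) (W : ℂ) : ℂ :=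
  ∑' k : ℕ+, (starRingEnd ℂ) (χ ((k : ℕ) : ZMod q)) * eC (k * W)

noncomputable def phxB {q : ℕ} (χ : DirichletCharacter ℂ q) (W : ℂ) : ℂ :=
  ∑' k : ℕ+, (starRingEnd ℂ) (χ ((k : ℕ) : ZMod q)) * eC (-(k * (starRingEnd ℂ) W))

lemma phxB_eq {q : ℕ} (χ : DirichletCharacter ℂ q) (W : ℂ) :
    phxB χ W = phxA χ (-(starRingEnd ℂ) W) := by
  simp [phxA, phxB]

lemma phxA_eq {q : ℕ} (χ : DirichletCharacter ℂ q) (W : ℂ) :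
    phxB χ (-(starRingEnd ℂ) W) = phxA χ W := by
  simp [phxA, phxB]

lemma phx_U {q : ℕ} [NeZero q] (hq : 1 < q) (χ : DirichletCharacter ℂ q) (hχ : χ.IsPrimitive)
    (W : ℂ) (hW : 0 < W.im) :
    ∑ r : Fin q, χ ((r : ℕ) : ZMod q) *
      ((∑' j : ℤ, (1 / Complex.normSq (W + (r : ℕ) / (q : ℂ) + j) : ℝ) : ℝ) : ℂ) =
    Real.pi / W.im * gaussSum χ (ZMod.stdAddChar (N := q)) *
      (phxA χ W + χ (-1) * phxB χ W) := by
  have him : ∀ r : Fin q, (W + (r : ℕ) / (q : ℂ)).im = W.im := by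
    intro r
    have : (((r : ℕ) : ℂ) / (q : ℂ)) = (((r : ℕ) / (q : ℝ) : ℝ) : ℂ) := by push_cast; rfl
    rw [this, Complex.add_im, Complex.ofReal_im, add_zero]
  have hpos : ∀ r : Fin q, 0 < (W + (r : ℕ) / (q : ℂ)).im := fun r => by rw [him]; exact hW
  set X : Fin q → ℂ := fun r => ∑' k : ℕ+, eC (k * (W + (r : ℕ) / (q : ℂ))) with hX
  have h1 : ∀ r : Fin q,
      ((∑' j : ℤ, (1 / Complex.normSq (W + (r : ℕ) / (q : ℂ) + j) : ℝ) : ℝ) : ℂ) =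
      Real.pi / W.im * (1 + X r + (starRingEnd ℂ) (X r)) := by
    intro r
    rw [phx_P _ (hpos r), him]
    rw [add_assoc, Complex.add_conj]
    push_cast
    rfl
  have hXs : ∀ r : Fin q, Summable fun k : ℕ+ => eC (k * (W + (r : ℕ) / (q : ℂ))) :=
    fun r => (phx_summable_eC _ (hpos r)).of_norm
  have hsA : ∑ r : Fin q, χ ((r : ℕ) : ZMod q) * X r =
      gaussSum χ (ZMod.stdAddChar (N := q)) * phxA χ W := by
    simp only [hX, ← tsum_mul_left]
    rw [← Summable.tsum_finsetSum (fun r _ => (hXs r).mul_left _), phxA, ← tsum_mul_left]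
    refine tsum_congr fun k => ?_
    have := phx_gauss χ hχ (k : ℕ)
    simp only [Int.cast_natCast] at this
    rw [← mul_assoc, mul_comm (gaussSum _ _), ← this, Finset.sum_mul]
    refine Finset.sum_congr rfl fun r _ => ?_
    rw [mul_add, phx_eC_add]
    ring
  have hsB : ∑ r : Fin q, χ ((r : ℕ) : ZMod q) * (starRingEnd ℂ) (X r) =
      gaussSum χ (ZMod.stdAddChar (N := q)) * (χ (-1) * phxB χ W) := by
    simp only [hX, Complex.conj_tsum, ← tsum_mul_left]
    have hXs' : ∀ r : Fin q, Summable fun k : ℕ+ =>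
        (starRingEnd ℂ) (eC (k * (W + (r : ℕ) / (q : ℂ)))) := 
      fun r => Complex.summable_conj.2 (hXs r)
    rw [← Summable.tsum_finsetSum (fun r _ => (hXs' r).mul_left _), phxB, ← tsum_mul_left,
      ← tsum_mul_left]
    refine tsum_congr fun k => ?_
    have := phx_gauss χ hχ (-(k : ℕ))
    have h5 : (starRingEnd ℂ) (χ (-1)) = χ (-1) := by
      rcases χ.even_or_odd with h | h
      · rw [h]; simp
      · rw [h]; simp
    have h4 : (starRingEnd ℂ) (χ ((-((k : ℕ) : ℤ) : ℤ) : ZMod q)) =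
        χ (-1) * (starRingEnd ℂ) (χ ((k : ℕ) : ZMod q)) := by
      rw [← h5, ← map_mul, ← map_mul]
      congr 2
      push_cast
      ring
    rw [h4] at this
    rw [show gaussSum χ (ZMod.stdAddChar (N := q)) * (χ (-1) * ((starRingEnd ℂ) (χ ((k : ℕ) : ZMod q))
      * eC (-(k * (starRingEnd ℂ) W)))) = (χ (-1) * (starRingEnd ℂ) (χ ((k : ℕ) : ZMod q)) *
      gaussSum χ (ZMod.stdAddChar (N := q))) * eC (-(k * (starRingEnd ℂ) W)) by ring, ← this,
      Finset.sum_mul]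
    refine Finset.sum_congr rfl fun r _ => ?_
    rw [phx_eC_conj, mul_assoc, ← phx_eC_add]
    congr 2
    simp
    ring
  simp only [h1]
  have : ∀ r : Fin q, χ ((r : ℕ) : ZMod q) * (Real.pi / W.im * (1 + X r + (starRingEnd ℂ) (X r))) =
      Real.pi / W.im * (χ ((r : ℕ) : ZMod q) + χ ((r : ℕ) : ZMod q) * X r +
        χ ((r : ℕ) : ZMod q) * (starRingEnd ℂ) (X r)) := fun r => by ring
  simp only [this]
  rw [← Finset.mul_sum, Finset.sum_add_distrib, Finset.sum_add_distrib, phx_sum_zero hq χ hχ,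
    hsA, hsB]
  ring

noncomputable def phxK (ε Q : ℝ) : ℝ := 1 / (Q * (1 + ε * Q))

noncomputable def phxQ (q : ℕ) (z : ℂ) (p : ℤ × ℤ) : ℝ :=
  Complex.normSq ((p.1 : ℂ) * q * z + p.2) / z.im

lemma phxK_zero (Q : ℝ) : phxK 0 Q = 1 / Q := by simp [phxK]

lemma phxK_diff (ε Q Q' : ℝ) (hε : 0 ≤ ε) (hQ : 0 < Q) (hQ' : 0 < Q') :
    |phxK ε Q - phxK ε Q'| ≤ |Q - Q'| / (Q * Q') := by
  have h1 : 0 < 1 + ε * Q := by positivity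
  have h2 : 0 < 1 + ε * Q' := by positivity
  have : phxK ε Q - phxK ε Q' = -((Q - Q') / (Q * Q')) *
      ((1 + ε * (Q + Q')) / ((1 + ε * Q) * (1 + ε * Q'))) := by
    unfold phxK
    field_simp
    ring
  rw [this, abs_mul, abs_neg, abs_div, abs_of_pos (mul_pos hQ hQ')]
  refine mul_le_of_le_one_right (by positivity) ?_
  rw [abs_of_pos (by positivity), div_le_one (by positivity)]
  nlinarith [mul_nonneg (mul_nonneg hε hQ.le) (mul_nonneg hε hQ'.le)]

lemma phx_real_bound (a a' s M : ℝ) (ha : 0 < a) (ha' : 0 < a') (hs : |a - a'| ≤ s)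
    (hM : 0 ≤ M) (haM : a ≤ M * a') :
    |a ^ 2 - a' ^ 2| / (a ^ 2 * a' ^ 2) ≤ s * (M ^ 2 + M) / a ^ 3 := by
  have hs0 : 0 ≤ s := (abs_nonneg _).trans hs
  rw [div_le_div_iff₀ (by positivity) (by positivity)]
  have h1 : |a ^ 2 - a' ^ 2| ≤ s * (a + a') := by
    rw [show a ^ 2 - a' ^ 2 = (a - a') * (a + a') by ring, abs_mul, abs_of_pos (add_pos ha ha')]
    gcongr
  have h2 : a * (a + a') ≤ (M ^ 2 + M) * a' ^ 2 := by
    have e1 : a * a ≤ (M * a') * (M * a') := by gcongr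
    have e2 : a * a' ≤ (M * a') * a' := by gcongr
    nlinarith
  calc |a ^ 2 - a' ^ 2| * a ^ 3 ≤ s * (a + a') * a ^ 3 := by gcongr
    _ = s * (a * (a + a')) * a ^ 2 := by ring
    _ ≤ s * ((M ^ 2 + M) * a' ^ 2) * a ^ 2 := by gcongr
    _ = _ := by ring

lemma phx_term_bound (q : ℕ) (hq : 0 < q) (z : ℂ) (hz : 0 < z.im) (ε : ℝ) (hε : 0 ≤ ε)
    (l j : ℤ) (hl : l ≠ 0) (r : Fin q) :
    |phxK ε (phxQ q z (l, j * q + (r : ℕ))) - phxK ε (phxQ q z (l, j * q))| ≤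
      z.im * (q * ((1 + 1 / z.im) ^ 2 + (1 + 1 / z.im))) / q ^ 3 * (1 / ‖(l : ℂ) * z + j‖ ^ 3) := by
  set A : ℂ := (q : ℂ) * (l * z + j) with hA
  have hq' : (0 : ℝ) < q := by exact_mod_cast hq
  have e1 : phxQ q z (l, j * q) = ‖A‖ ^ 2 / z.im := by
    rw [phxQ, Complex.normSq_eq_norm_sq]
    congr 3
    push_cast
    ring
  have e2 : phxQ q z (l, j * q + (r : ℕ)) = ‖A + (r : ℕ)‖ ^ 2 / z.im := by
    rw [phxQ, Complex.normSq_eq_norm_sq]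
    congr 3
    push_cast
    ring
  have hl1 : (1 : ℝ) ≤ |(l : ℝ)| := by exact_mod_cast Int.one_le_abs hl
  have hAim : A.im = q * (l * z.im) := by simp [hA]
  have hlow : ∀ w : ℂ, w.im = A.im → q * z.im ≤ ‖w‖ := by
    intro w hw
    refine le_trans ?_ (Complex.abs_im_le_norm w)
    rw [hw, hAim, abs_mul, abs_mul, abs_of_pos hq', abs_of_pos hz]
    have : 1 * z.im ≤ |(l : ℝ)| * z.im := by gcongr
    nlinarith
  have hlA := hlow A rfl
  have hlA' := hlow (A + (r : ℕ)) (by simp)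
  have hqz : 0 < q * z.im := by positivity
  have ha : 0 < ‖A‖ := by linarith
  have ha' : 0 < ‖A + (r : ℕ)‖ := by linarith
  have hr : ‖((r : ℕ) : ℂ)‖ ≤ q := by
    rw [Complex.norm_natCast]; exact_mod_cast r.2.le
  have hd : |‖A + (r : ℕ)‖ - ‖A‖| ≤ q := by
    refine (abs_norm_sub_norm_le _ _).trans ?_
    simpa using hr
  have hM : ‖A‖ ≤ (1 + 1 / z.im) * ‖A + (r : ℕ)‖ := by
    have h1 : ‖A‖ ≤ ‖A + (r : ℕ)‖ + q := by linarith [(abs_le.1 hd).1]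
    have h2 : (q : ℝ) ≤ 1 / z.im * ‖A + (r : ℕ)‖ := by
      rw [one_div, inv_mul_eq_div, le_div_iff₀ hz]; exact hlA'
    linarith
  have hb := phx_real_bound ‖A‖ ‖A + (r : ℕ)‖ q (1 + 1 / z.im) ha ha' (by rwa [abs_sub_comm])
    (by positivity) hM
  refine (phxK_diff ε _ _ hε ?_ ?_).trans ?_
  · rw [e2]; positivity
  · rw [e1]; positivity
  rw [e1, e2]
  have h3 : |‖A + (r : ℕ)‖ ^ 2 / z.im - ‖A‖ ^ 2 / z.im| /
      (‖A + (r : ℕ)‖ ^ 2 / z.im * (‖A‖ ^ 2 / z.im)) =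
      z.im * (|‖A‖ ^ 2 - ‖A + (r : ℕ)‖ ^ 2| / (‖A‖ ^ 2 * ‖A + (r : ℕ)‖ ^ 2)) := by
    rw [← sub_div, abs_div, abs_of_pos hz, abs_sub_comm]
    field_simp
  rw [h3]
  refine (mul_le_mul_of_nonneg_left hb hz.le).trans (le_of_eq ?_)
  have : ‖A‖ = q * ‖(l : ℂ) * z + j‖ := by rw [hA, norm_mul, Complex.norm_natCast]
  rw [this, mul_pow]
  have : ‖(l : ℂ) * z + j‖ ≠ 0 := by
    intro h; rw [h] at this; linarith
  field_simp

lemma phx_summable_K (q : ℕ) (hq : 0 < q) (z : ℂ) (hz : 0 < z.im) (ε : ℝ) (hε : 0 < ε) :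
    Summable fun p : ℤ × ℤ => phxK ε (phxQ q z p) := by
  have hw : 0 < ((q : ℂ) * z).im := by
    have : (0 : ℝ) < q := by exact_mod_cast hq
    simp; positivity
  have h := (phx_summable_plane _ hw 4 (by norm_num)).mul_left (z.im ^ 2 / ε)
  have hQ0 : ∀ p, 0 ≤ phxQ q z p := fun p => by
    unfold phxQ; exact div_nonneg (Complex.normSq_nonneg _) hz.le
  refine Summable.of_nonneg_of_le (fun p => ?_) (fun p => ?_) h
  · have := hQ0 p
    unfold phxK; positivity
  · have hQe : phxQ q z p = ‖(p.1 : ℂ) * (q * z) + p.2‖ ^ 2 / z.im := by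
      rw [phxQ, Complex.normSq_eq_norm_sq, mul_assoc]
    rcases (norm_nonneg ((p.1 : ℂ) * (q * z) + p.2)).eq_or_lt with h0 | h0
    · rw [hQe, ← h0]; simp [phxK]
    · have hQ : 0 < phxQ q z p := by rw [hQe]; positivity
      have h1 : phxK ε (phxQ q z p) ≤ 1 / (ε * phxQ q z p ^ 2) := by
        unfold phxK
        apply one_div_le_one_div_of_le (by positivity)
        nlinarith
      refine h1.trans (le_of_eq ?_)
      rw [hQe]
      field_simp

lemma phx_inner (q : ℕ) (hq : 0 < q) (z : ℂ) (l j : ℤ) (r : Fin q) :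
    phxK 0 (phxQ q z (l, j * q + (r : ℕ))) =
      z.im / q ^ 2 * (1 / Complex.normSq ((l : ℂ) * z + (r : ℕ) / (q : ℂ) + j)) := by
  have hq' : (q : ℂ) ≠ 0 := by exact_mod_cast hq.ne'
  rw [phxK_zero, phxQ]
  have : ((l : ℂ) * q * z + ((j * q + (r : ℕ) : ℤ) : ℂ)) =
      q * ((l : ℂ) * z + (r : ℕ) / (q : ℂ) + j) := by
    push_cast
    field_simp
    ring
  simp only [this]
  rw [Complex.normSq_mul, Complex.normSq_natCast]
  rw [one_div_div, div_mul_div_comm, mul_one, sq]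

lemma phx_lim {q₁ q₂ : ℕ} (hq₁ : 1 < q₁) (hq₂ : 1 < q₂)
    (χ₁ : DirichletCharacter ℂ q₁) (χ₂ : DirichletCharacter ℂ q₂)
    (hχ₂ : χ₂.IsPrimitive) (z : ℂ) (hz : 0 < z.im) :
    (Summable fun l : ℤ => χ₁ (l : ZMod q₁) * (((z.im / q₂ ^ 2 : ℝ) : ℂ) *
      ∑ r : Fin q₂, χ₂ ((r : ℕ) : ZMod q₂) *
        ((∑' j : ℤ, (1 / Complex.normSq ((l : ℂ) * z + (r : ℕ) / (q₂ : ℂ) + j) : ℝ) : ℝ) : ℂ))) ∧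
    Tendsto (fun ε : ℝ => ∑' p : ℤ × ℤ, χ₁ (p.1 : ZMod q₁) * χ₂ (p.2 : ZMod q₂) *
      ((phxK ε (phxQ q₂ z p) : ℝ) : ℂ)) (𝓝[>] 0)
    (𝓝 (∑' l : ℤ, χ₁ (l : ZMod q₁) * (((z.im / q₂ ^ 2 : ℝ) : ℂ) *
      ∑ r : Fin q₂, χ₂ ((r : ℕ) : ZMod q₂) *
        ((∑' j : ℤ, (1 / Complex.normSq ((l : ℂ) * z + (r : ℕ) / (q₂ : ℂ) + j) : ℝ) : ℝ) : ℂ)))) := by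
  have : NeZero q₂ := ⟨by omega⟩
  have hf1 : Fact (1 < q₁) := ⟨hq₁⟩
  have hq₂0 : 0 < q₂ := by omega
  set H : ℝ → ℤ × ℤ → ℂ := fun ε p => ∑ r : Fin q₂, χ₁ (p.1 : ZMod q₁) *
    (χ₂ ((r : ℕ) : ZMod q₂) * ((phxK ε (phxQ q₂ z (p.1, p.2 * q₂ + (r : ℕ))) : ℝ) : ℂ)) with hH
  set C : ℝ := z.im * (q₂ * ((1 + 1 / z.im) ^ 2 + (1 + 1 / z.im))) / q₂ ^ 3 with hC
  have hC0 : 0 ≤ C := by positivity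
  have hsb : Summable fun p : ℤ × ℤ => q₂ * (C * (1 / ‖(p.1 : ℂ) * z + p.2‖ ^ 3)) :=
    ((phx_summable_plane z hz 3 le_rfl).mul_left _).mul_left _
  have hbound : ∀ ε : ℝ, 0 ≤ ε → ∀ p, ‖H ε p‖ ≤ q₂ * (C * (1 / ‖(p.1 : ℂ) * z + p.2‖ ^ 3)) := by
    intro ε hε p
    by_cases hl : p.1 = 0
    · have : H ε p = 0 := by simp [hH, hl, MulChar.map_zero]
      rw [this, norm_zero]
      positivity
    · have h1 : H ε p = ∑ r : Fin q₂, χ₁ (p.1 : ZMod q₁) * (χ₂ ((r : ℕ) : ZMod q₂) *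
          ((phxK ε (phxQ q₂ z (p.1, p.2 * q₂ + (r : ℕ))) - phxK ε (phxQ q₂ z (p.1, p.2 * q₂)) : ℝ)
            : ℂ)) := by
        simp only [hH, Complex.ofReal_sub, mul_sub, Finset.sum_sub_distrib]
        rw [← Finset.mul_sum Finset.univ (fun r : Fin q₂ => χ₂ ((r : ℕ) : ZMod q₂) * 
          ((phxK ε (phxQ q₂ z (p.1, p.2 * q₂)) : ℝ) : ℂ)), ← Finset.sum_mul,
          phx_sum_zero hq₂ χ₂ hχ₂]
        simp
      rw [h1]
      refine (norm_sum_le _ _).trans ?_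
      have : ∀ r ∈ (Finset.univ : Finset (Fin q₂)), ‖χ₁ (p.1 : ZMod q₁) * (χ₂ ((r : ℕ) : ZMod q₂) *
          ((phxK ε (phxQ q₂ z (p.1, p.2 * q₂ + (r : ℕ))) - phxK ε (phxQ q₂ z (p.1, p.2 * q₂)) : ℝ)
            : ℂ))‖ ≤ C * (1 / ‖(p.1 : ℂ) * z + p.2‖ ^ 3) := by
        intro r _
        rw [norm_mul, norm_mul, Complex.norm_real, Real.norm_eq_abs]
        have b1 := χ₁.norm_le_one (p.1 : ZMod q₁)
        have b2 := χ₂.norm_le_one ((r : ℕ) : ZMod q₂)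
        have b3 := phx_term_bound q₂ hq₂0 z hz ε hε p.1 p.2 hl r
        refine le_trans ?_ b3
        refine (mul_le_of_le_one_left (by positivity) b1).trans ?_
        exact mul_le_of_le_one_left (by positivity) b2
      refine (Finset.sum_le_sum this).trans (le_of_eq ?_)
      simp
  have hlim : Tendsto (fun ε => ∑' p, H ε p) (𝓝[>] 0) (𝓝 (∑' p, H 0 p)) := by
    refine tendsto_tsum_of_dominated_convergence hsb (fun p => ?_) ?_
    · refine tendsto_finsetSum _ fun r _ => ?_
      refine Tendsto.const_mul _ (Tendsto.const_mul _ ?_)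
      refine (Complex.continuous_ofReal.tendsto _).comp ?_
      refine Tendsto.mono_left ?_ nhdsWithin_le_nhds
      generalize phxQ q₂ z (p.1, p.2 * q₂ + (r : ℕ)) = Q
      by_cases hQ : Q = 0
      · simp [phxK, hQ]
      · refine ContinuousAt.tendsto ?_
        unfold phxK
        refine ContinuousAt.div (by fun_prop) (by fun_prop) ?_
        simpa using hQ
    · filter_upwards [self_mem_nhdsWithin] with ε hε p
      exact hbound ε (le_of_lt hε) p
  have hs0 : Summable (H 0) := Summable.of_norm_bounded hsb (hbound 0 le_rfl)
  have hrow : ∀ l : ℤ, ∑' j : ℤ, H 0 (l, j) = χ₁ (l : ZMod q₁) * (((z.im / q₂ ^ 2 : ℝ) : ℂ) *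
      ∑ r : Fin q₂, χ₂ ((r : ℕ) : ZMod q₂) *
        ((∑' j : ℤ, (1 / Complex.normSq ((l : ℂ) * z + (r : ℕ) / (q₂ : ℂ) + j) : ℝ) : ℝ) : ℂ)) := by
    intro l
    have hsr : ∀ r : Fin q₂, Summable fun j : ℤ =>
        ((1 / Complex.normSq ((l : ℂ) * z + (r : ℕ) / (q₂ : ℂ) + j) : ℝ) : ℂ) :=
      fun r => Complex.summable_ofReal.2 (phx_summable_line _)
    simp only [hH, phx_inner q₂ hq₂0, Complex.ofReal_mul (z.im / q₂ ^ 2)]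
    rw [Summable.tsum_finsetSum (fun r _ => (((hsr r).mul_left _).mul_left _).mul_left _)]
    simp only [tsum_mul_left, Complex.ofReal_tsum, Finset.mul_sum]
    refine Finset.sum_congr rfl fun r _ => ?_
    ring
  have hfun := funext hrow
  refine ⟨?_, ?_⟩
  · rw [← hfun]
    exact hs0.prod
  · rw [← hfun, ← hs0.tsum_prod]
    refine hlim.congr' ?_
    filter_upwards [self_mem_nhdsWithin] with ε hε
    have hε' : 0 < ε := hε
    have hsK : Summable fun p : ℤ × ℤ => χ₁ (p.1 : ZMod q₁) * χ₂ (p.2 : ZMod q₂) *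
      ((phxK ε (phxQ q₂ z p) : ℝ) : ℂ) := by
      refine Summable.of_norm_bounded (phx_summable_K q₂ hq₂0 z hz ε hε').norm (fun p => ?_)
      rw [norm_mul, Complex.norm_real]
      refine mul_le_of_le_one_left (norm_nonneg _) ?_
      rw [norm_mul]
      exact mul_le_one₀ (χ₁.norm_le_one _) (norm_nonneg _) (χ₂.norm_le_one _)
    let e : (ℤ × ℤ) × Fin q₂ ≃ ℤ × ℤ :=
      (Equiv.prodAssoc ℤ ℤ (Fin q₂)).trans
        (Equiv.prodCongr (Equiv.refl ℤ) (Int.divModEquiv q₂).symm)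
    have he : ∀ x, e x = (x.1.1, x.1.2 * q₂ + (x.2 : ℕ)) := fun x => rfl
    rw [← e.tsum_eq (fun p : ℤ × ℤ => χ₁ (p.1 : ZMod q₁) * χ₂ (p.2 : ZMod q₂) *
      ((phxK ε (phxQ q₂ z p) : ℝ) : ℂ))]
    have hsKe := e.summable_iff.2 hsK
    rw [Summable.tsum_prod (f := fun c => χ₁ ((e c).1 : ZMod q₁) * χ₂ ((e c).2 : ZMod q₂) *
      ((phxK ε (phxQ q₂ z (e c)) : ℝ) : ℂ)) hsKe]
    refine tsum_congr fun p => ?_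
    rw [tsum_fintype]
    refine Finset.sum_congr rfl fun r _ => ?_
    rw [he]
    simp
    ring

lemma phx_eC_conj_norm (w : ℂ) : ‖eC (-(starRingEnd ℂ) w)‖ = ‖eC w‖ := by
  rw [← phx_eC_conj, Complex.norm_conj]

lemma phx_summable_A {q₁ q₂ : ℕ} (χ₁ : DirichletCharacter ℂ q₁) (χ₂ : DirichletCharacter ℂ q₂)
    (z : ℂ) (hz : 0 < z.im) :
    Summable fun l : ℕ+ => χ₁ ((l : ℕ) : ZMod q₁) / (l : ℂ) * phxA χ₂ ((l : ℂ) * z) := by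
  set ρ := ‖eC z‖ with hρ
  have hρ0 : 0 ≤ ρ := norm_nonneg _
  have hρ1 : ρ < 1 := phx_norm_eC_lt z hz
  have hg := summable_geometric_of_lt_one hρ0 hρ1
  have hgp : Summable fun l : ℕ+ => ρ ^ (l : ℕ) :=
    (summable_pnat_iff_summable_nat (f := fun k : ℕ => ρ ^ k)).2 hg
  have hgs : Summable fun k : ℕ+ => ρ ^ ((k : ℕ) - 1) := by
    rw [summable_pnat_iff_summable_succ (f := fun k : ℕ => ρ ^ (k - 1))]
    simpa using hg
  refine Summable.of_norm_bounded (hgp.mul_left (∑' k : ℕ+, ρ ^ ((k : ℕ) - 1))) fun l => ?_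
  have hl : (1 : ℝ) ≤ (l : ℕ) := by exact_mod_cast l.2
  have h1 : ‖χ₁ ((l : ℕ) : ZMod q₁) / (l : ℂ)‖ ≤ 1 := by
    rw [norm_div, Complex.norm_natCast]
    exact div_le_one_of_le₀ ((χ₁.norm_le_one _).trans hl) (by positivity)
  rw [norm_mul]
  refine (mul_le_of_le_one_left (norm_nonneg _) h1).trans ?_
  unfold phxA
  refine tsum_of_norm_bounded (hgs.hasSum.mul_right _) fun k => ?_
  rw [norm_mul, Complex.norm_conj]
  refine (mul_le_of_le_one_left (norm_nonneg _) (χ₂.norm_le_one _)).trans ?_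
  have : ((k : ℕ) : ℂ) * (((l : ℕ) : ℂ) * z) = ((k * l : ℕ) : ℂ) * z := by push_cast; ring
  rw [this, phx_eC_nat, norm_pow, ← pow_add]
  refine pow_le_pow_of_le_one hρ0 hρ1.le ?_
  obtain ⟨a, ha⟩ := Nat.exists_eq_succ_of_ne_zero k.ne_zero
  obtain ⟨b, hb⟩ := Nat.exists_eq_succ_of_ne_zero l.ne_zero
  rw [ha, hb]
  simp
  nlinarith

lemma phx_summable_B {q₁ q₂ : ℕ} (χ₁ : DirichletCharacter ℂ q₁) (χ₂ : DirichletCharacter ℂ q₂)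
    (z : ℂ) (hz : 0 < z.im) :
    Summable fun l : ℕ+ => χ₁ ((l : ℕ) : ZMod q₁) / (l : ℂ) * phxB χ₂ ((l : ℂ) * z) := by
  have := phx_summable_A χ₁ χ₂ (-(starRingEnd ℂ) z) (by simpa using hz)
  refine this.congr fun l => ?_
  rw [phxB_eq]
  simp

lemma phx_fE {q₁ q₂ : ℕ} (χ₁ : DirichletCharacter ℂ q₁) (χ₂ : DirichletCharacter ℂ q₂) (z : ℂ) :
    fE χ₁ χ₂ z = ∑' l : ℕ+, χ₁ ((l : ℕ) : ZMod q₁) / (l : ℂ) * phxA χ₂ ((l : ℂ) * z) := by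
  unfold fE phxA
  refine tsum_congr fun l => ?_
  rw [← tsum_mul_left]
  refine tsum_congr fun k => ?_
  rw [mul_assoc (k : ℂ)]
  ring

lemma phx_fE_conj {q₁ q₂ : ℕ} (χ₁ : DirichletCharacter ℂ q₁) (χ₂ : DirichletCharacter ℂ q₂)
    (z : ℂ) :
    (starRingEnd ℂ) (fE (χ₁.ringHomComp (starRingEnd ℂ)) (χ₂.ringHomComp (starRingEnd ℂ)) z) =
      ∑' l : ℕ+, χ₁ ((l : ℕ) : ZMod q₁) / (l : ℂ) * phxB χ₂ ((l : ℂ) * z) := by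
  unfold fE phxB
  rw [Complex.conj_tsum]
  refine tsum_congr fun l => ?_
  rw [← tsum_mul_left, Complex.conj_tsum]
  refine tsum_congr fun k => ?_
  simp only [map_mul, map_div₀, MulChar.ringHomComp_apply, Complex.conj_conj, phx_eC_conj,
    Complex.conj_natCast]
  rw [mul_assoc (k : ℂ)]
  ring

lemma phx_value {q₁ q₂ : ℕ} [NeZero q₂] (hq₁ : 1 < q₁) (hq₂ : 1 < q₂)
    (χ₁ : DirichletCharacter ℂ q₁) (χ₂ : DirichletCharacter ℂ q₂)
    (hχ₂ : χ₂.IsPrimitive) (hpar : χ₁ (-1) * χ₂ (-1) = 1) (z : ℂ) (hz : 0 < z.im) :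
    ∑' l : ℤ, χ₁ (l : ZMod q₁) * (((z.im / q₂ ^ 2 : ℝ) : ℂ) *
      ∑ r : Fin q₂, χ₂ ((r : ℕ) : ZMod q₂) *
        ((∑' j : ℤ, (1 / Complex.normSq ((l : ℂ) * z + (r : ℕ) / (q₂ : ℂ) + j) : ℝ) : ℝ) : ℂ)) =
    2 * (Real.pi / q₂ ^ 2 * gaussSum χ₂ (ZMod.stdAddChar (N := q₂))) *
      (fE χ₁ χ₂ z + χ₂ (-1) * (starRingEnd ℂ)
        (fE (χ₁.ringHomComp (starRingEnd ℂ)) (χ₂.ringHomComp (starRingEnd ℂ)) z)) := by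
  have hsum := (phx_lim hq₁ hq₂ χ₁ χ₂ hχ₂ z hz).1
  have hf1 : Fact (1 < q₁) := ⟨hq₁⟩
  set U : ℤ → ℂ := fun l => ∑ r : Fin q₂, χ₂ ((r : ℕ) : ZMod q₂) *
        ((∑' j : ℤ, (1 / Complex.normSq ((l : ℂ) * z + (r : ℕ) / (q₂ : ℂ) + j) : ℝ) : ℝ) : ℂ)
    with hU
  have hU1 : ∀ l : ℤ, 0 < l → U l = Real.pi / ((l : ℂ) * z.im) *
      gaussSum χ₂ (ZMod.stdAddChar (N := q₂)) *
      (phxA χ₂ (l * z) + χ₂ (-1) * phxB χ₂ (l * z)) := by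
    intro l hl
    have hl' : (0 : ℝ) < l := by exact_mod_cast hl
    have him : ((l : ℂ) * z).im = l * z.im := by simp
    have := phx_U hq₂ χ₂ hχ₂ ((l : ℂ) * z) (by rw [him]; positivity)
    rw [him] at this
    simp only [hU]
    rw [this]
    push_cast
    rfl
  have hsq : χ₂ (-1) * χ₂ (-1) = 1 := by
    rw [← map_mul]; simp
  have hU2 : ∀ l : ℤ, 0 < l → U (-l) = χ₂ (-1) * U l := by
    intro l hl
    have hl' : (0 : ℝ) < l := by exact_mod_cast hl
    have him : (-(starRingEnd ℂ) ((l : ℂ) * z)).im = l * z.im := by simp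
    have := phx_U hq₂ χ₂ hχ₂ (-(starRingEnd ℂ) ((l : ℂ) * z)) (by rw [him]; positivity)
    rw [him, ← phxB_eq, phxA_eq] at this
    have h2 : U (-l) = ∑ r : Fin q₂, χ₂ ((r : ℕ) : ZMod q₂) *
      ((∑' j : ℤ, (1 / Complex.normSq (-(starRingEnd ℂ) ((l : ℂ) * z) +
        (r : ℕ) / (q₂ : ℂ) + j) : ℝ) : ℝ) : ℂ) := by
      simp only [hU]
      refine Finset.sum_congr rfl fun r _ => ?_
      congr 2
      refine tsum_congr fun j => ?_
      rw [← Complex.normSq_conj]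
      congr 2
      simp
    rw [h2, this, hU1 l hl]
    push_cast
    linear_combination (-(Real.pi / ((l : ℂ) * z.im) *
      gaussSum χ₂ (ZMod.stdAddChar (N := q₂))) * phxB χ₂ (l * z)) * hsq
  have heven1 : ∀ l : ℤ, 0 < l → χ₁ ((-l : ℤ) : ZMod q₁) * (((z.im / q₂ ^ 2 : ℝ) : ℂ) * U (-l)) =
      χ₁ (l : ZMod q₁) * (((z.im / q₂ ^ 2 : ℝ) : ℂ) * U l) := by
    intro l hl
    rw [hU2 l hl]
    have : χ₁ ((-l : ℤ) : ZMod q₁) = χ₁ (-1) * χ₁ (l : ZMod q₁) := by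
      rw [← map_mul]; congr 1; push_cast; ring
    rw [this]
    linear_combination (χ₁ (l : ZMod q₁) * (((z.im / q₂ ^ 2 : ℝ) : ℂ) * U l)) * hpar
  have heven : Function.Even (fun l : ℤ => χ₁ (l : ZMod q₁) * (((z.im / q₂ ^ 2 : ℝ) : ℂ) * U l)) := by
    intro l
    rcases lt_trichotomy l 0 with h | h | h
    · have := heven1 (-l) (by omega)
      rw [neg_neg] at this
      exact this.symm
    · subst h; simp
    · exact heven1 l h
  rw [tsum_int_eq_zero_add_two_mul_tsum_pnat heven hsum]
  have hzero : χ₁ ((0 : ℤ) : ZMod q₁) = 0 := by simp [MulChar.map_zero]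
  rw [hzero, zero_mul, zero_add, phx_fE, phx_fE_conj, ← tsum_mul_left,
    ← (phx_summable_A χ₁ χ₂ z hz).tsum_add ((phx_summable_B χ₁ χ₂ z hz).mul_left _),
    mul_assoc (2 : ℂ), ← tsum_mul_left, nsmul_eq_mul]
  congr 1
  refine tsum_congr fun l => ?_
  rw [hU1 _ (by exact_mod_cast l.2)]
  have hl0 : ((l : ℕ) : ℂ) ≠ 0 := by exact_mod_cast l.ne_zero
  have hz0 : (z.im : ℂ) ≠ 0 := by exact_mod_cast hz.ne'
  have hq0 : (q₂ : ℂ) ≠ 0 := by exact_mod_cast (NeZero.ne q₂)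
  simp only [Int.cast_natCast]
  push_cast
  field_simp

lemma phx_transform {q₁ q₂ : ℕ}
    (χ₁ : DirichletCharacter ℂ q₁) (χ₂ : DirichletCharacter ℂ q₂)
    (a b c d : ℤ) (hdet : a * d - b * c = 1) (hΓ : ((q₁ * q₂ : ℕ) : ℤ) ∣ c)
    (z : ℂ) (hz : 0 < z.im) (hcz : (c : ℂ) * z + d ≠ 0)
    (him : (((a : ℂ) * z + b) / ((c : ℂ) * z + d)).im = z.im / Complex.normSq ((c : ℂ) * z + d))
    (ε : ℝ) :
    ∑' p : ℤ × ℤ, χ₁ (p.1 : ZMod q₁) * χ₂ (p.2 : ZMod q₂) *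
      ((phxK ε (phxQ q₂ (((a : ℂ) * z + b) / ((c : ℂ) * z + d)) p) : ℝ) : ℂ) =
    χ₁ (d : ZMod q₁) * (starRingEnd ℂ) (χ₂ (d : ZMod q₂)) *
      ∑' p : ℤ × ℤ, χ₁ (p.1 : ZMod q₁) * χ₂ (p.2 : ZMod q₂) *
        ((phxK ε (phxQ q₂ z p) : ℝ) : ℂ) := by
  obtain ⟨c', rfl⟩ := hΓ
  let σ : ℤ × ℤ ≃ ℤ × ℤ :=
    { toFun := fun p => (p.1 * a + p.2 * (q₁ * c'), p.1 * (q₂ * b) + p.2 * d)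
      invFun := fun p => (p.1 * d - p.2 * (q₁ * c'), - p.1 * (q₂ * b) + p.2 * a)
      left_inv := fun p => by
        push_cast at hdet
        ext
        · linear_combination p.1 * hdet
        · linear_combination p.2 * hdet
      right_inv := fun p => by
        push_cast at hdet
        ext
        · linear_combination p.1 * hdet
        · linear_combination p.2 * hdet }
  have hσ : ∀ p, σ p = (p.1 * a + p.2 * (q₁ * c'), p.1 * (q₂ * b) + p.2 * d) := fun p => rfl
  rw [← σ.tsum_eq (fun p : ℤ × ℤ => χ₁ (p.1 : ZMod q₁) * χ₂ (p.2 : ZMod q₂) *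
        ((phxK ε (phxQ q₂ z p) : ℝ) : ℂ)), ← tsum_mul_left]
  have h1 : χ₁ (d : ZMod q₁) * χ₁ (a : ZMod q₁) = 1 := by
    rw [← map_mul, ← map_one χ₁]
    congr 1
    have := congrArg (Int.cast : ℤ → ZMod q₁) hdet
    push_cast at this
    simp at this
    rw [mul_comm]; exact this
  have hdu : (a : ZMod q₂) * (d : ZMod q₂) = 1 := by
    have := congrArg (Int.cast : ℤ → ZMod q₂) hdet
    push_cast at this
    simpa using this
  have h2 : (starRingEnd ℂ) (χ₂ (d : ZMod q₂)) * χ₂ (d : ZMod q₂) = 1 := by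
    rw [phx_conj_inv, ← MulChar.mul_apply, inv_mul_cancel,
      MulChar.one_apply (IsUnit.of_mul_eq_one_right _ hdu)]
  refine tsum_congr fun p => ?_
  have hQ : phxQ q₂ (((a : ℂ) * z + b) / ((((q₁ * q₂ : ℕ) : ℤ) * c' : ℤ) * z + d)) p =
      phxQ q₂ z (σ p) := by
    rw [hσ]
    unfold phxQ
    rw [him]
    have hn : Complex.normSq ((((q₁ * q₂ : ℕ) : ℤ) * c' : ℤ) * z + d) ≠ 0 := by
      simpa using hcz
    have : ((((p.1 * a + p.2 * (q₁ * c') : ℤ) : ℂ) * q₂ * z + ((p.1 * (q₂ * b) + p.2 * d : ℤ) : ℂ)))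
        = ((p.1 : ℂ) * q₂ * (((a : ℂ) * z + b) / ((((q₁ * q₂ : ℕ) : ℤ) * c' : ℤ) * z + d)) + p.2) *
          ((((q₁ * q₂ : ℕ) : ℤ) * c' : ℤ) * z + d) := by
      rw [add_mul, mul_assoc _ (_ / _), div_mul_cancel₀ _ hcz]
      push_cast
      ring
    simp only [this]
    rw [Complex.normSq_mul]
    field_simp
  rw [hQ]
  have e1 : χ₁ ((σ p).1 : ZMod q₁) = χ₁ (p.1 : ZMod q₁) * χ₁ (a : ZMod q₁) := by
    rw [hσ, ← map_mul]; simp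
  have e2 : χ₂ ((σ p).2 : ZMod q₂) = χ₂ (p.2 : ZMod q₂) * χ₂ (d : ZMod q₂) := by
    rw [hσ, ← map_mul]; simp
  rw [e1, e2]
  have h12 : (χ₁ (d : ZMod q₁) * χ₁ (a : ZMod q₁)) *
      ((starRingEnd ℂ) (χ₂ (d : ZMod q₂)) * χ₂ (d : ZMod q₂)) = 1 := by rw [h1, h2, one_mul]
  linear_combination (-(χ₁ (p.1 : ZMod q₁) * χ₂ (p.2 : ZMod q₂) *
    ((phxK ε (phxQ q₂ z (σ p)) : ℝ) : ℂ))) * h12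

theorem phi_conjugation_relation
    {q₁ q₂ : ℕ} (hq₁ : 1 < q₁) (hq₂ : 1 < q₂)
    (χ₁ : DirichletCharacter ℂ q₁) (χ₂ : DirichletCharacter ℂ q₂)
    (hχ₁ : χ₁.IsPrimitive) (hχ₂ : χ₂.IsPrimitive)
    (hpar : χ₁ (-1) * χ₂ (-1) = 1)
    (a b c d : ℤ) (hdet : a * d - b * c = 1) (hΓ : ((q₁ * q₂ : ℕ) : ℤ) ∣ c)
    (z : ℂ) (hz : 0 < z.im) :
    fE χ₁ χ₂ (((a : ℂ) * z + (b : ℂ)) / ((c : ℂ) * z + (d : ℂ))) -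
      χ₁ ((d : ℤ) : ZMod q₁) * (starRingEnd ℂ) (χ₂ ((d : ℤ) : ZMod q₂)) * fE χ₁ χ₂ z =
    -χ₂ (-1) * (starRingEnd ℂ)
      (fE (χ₁.ringHomComp (starRingEnd ℂ)) (χ₂.ringHomComp (starRingEnd ℂ))
          (((a : ℂ) * z + (b : ℂ)) / ((c : ℂ) * z + (d : ℂ))) -
        (χ₁.ringHomComp (starRingEnd ℂ)) ((d : ℤ) : ZMod q₁) * χ₂ ((d : ℤ) : ZMod q₂) *
          fE (χ₁.ringHomComp (starRingEnd ℂ)) (χ₂.ringHomComp (starRingEnd ℂ)) z) := by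
  have : NeZero q₂ := ⟨by omega⟩
  have hcz : (c : ℂ) * z + d ≠ 0 := by
    intro h
    have h1 := congrArg Complex.im h
    simp at h1
    have hc : c = 0 := by
      rcases h1 with h1 | h1
      · exact h1
      · exact absurd h1 hz.ne'
    have hd : d = 0 := by
      rw [hc] at h
      simpa using h
    rw [hc, hd] at hdet
    simp at hdet
  have hn : Complex.normSq ((c : ℂ) * z + d) ≠ 0 := by simpa using hcz
  have him : (((a : ℂ) * z + b) / ((c : ℂ) * z + d)).im =
      z.im / Complex.normSq ((c : ℂ) * z + d) := by
    have hdet' : (a : ℝ) * d - b * c = 1 := by exact_mod_cast hdet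
    rw [Complex.div_im, ← sub_div]
    congr 1
    simp
    linear_combination z.im * hdet'
  have hz' : 0 < (((a : ℂ) * z + b) / ((c : ℂ) * z + d)).im := by
    rw [him]
    exact div_pos hz (lt_of_le_of_ne (Complex.normSq_nonneg _) hn.symm)
  have l1 := (phx_lim hq₁ hq₂ χ₁ χ₂ hχ₂ _ hz').2
  have l2 := ((phx_lim hq₁ hq₂ χ₁ χ₂ hχ₂ z hz).2).const_mul
    (χ₁ (d : ZMod q₁) * (starRingEnd ℂ) (χ₂ (d : ZMod q₂)))
  simp only [phx_transform χ₁ χ₂ a b c d hdet hΓ z hz hcz him] at l1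
  have key := tendsto_nhds_unique l1 l2
  rw [phx_value hq₁ hq₂ χ₁ χ₂ hχ₂ hpar _ hz', phx_value hq₁ hq₂ χ₁ χ₂ hχ₂ hpar _ hz] at key
  have hκ : (2 * (Real.pi / q₂ ^ 2 * gaussSum χ₂ (ZMod.stdAddChar (N := q₂))) : ℂ) ≠ 0 := by
    have h1 := phx_gauss_ne χ₂ hχ₂
    have h2 : (Real.pi : ℂ) ≠ 0 := by exact_mod_cast Real.pi_ne_zero
    have h3 : (q₂ : ℂ) ≠ 0 := by exact_mod_cast (NeZero.ne q₂)
    exact mul_ne_zero two_ne_zero (mul_ne_zero (div_ne_zero h2 (pow_ne_zero 2 h3)) h1)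
  have key2 := mul_left_cancel₀ hκ (key.trans (mul_left_comm _ _ _))
  rw [map_sub, map_mul, map_mul, MulChar.ringHomComp_apply, Complex.conj_conj]
  linear_combination key2
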